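/- Let n ≥ 1, let O be a valuation δ-subring of R whose residue field O/pO is finite, let α be an n×n matrix with entries in O, and let u ∈ GL_n(R) satisfy φ(u) = (1+pα)·u^(p). Then the δ-Galois group G_{u/O} is a finite set. -/

import Mathlib

noncomputable section

open Matrix

/-- `R = W(k)`, `k` the algebraic closure of `𝔽_p`. -/
abbrev Rp (p : ℕ) [Fact p.Prime] : Type _ :=
  WittVector p (AlgebraicClosure (ZMod p))

/-- `φ`, the unique Frobenius lift on `R`. -/
abbrev frobW (p : ℕ) [Fact p.Prime] : Rp p →+* Rp p :=
  WittVector.frobenius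

/-- `K`, the fraction field of `R`. -/
abbrev Kp (p : ℕ) [Fact p.Prime] : Type _ := FractionRing (Rp p)

/-- `O[u]`, the subring of `R` generated by `O` and the entries of `u`. -/
def genBy {p : ℕ} [Fact p.Prime] {n : ℕ} (O : Subring (Rp p))
    (u : Matrix (Fin n) (Fin n) (Rp p)) : Subring (Rp p) :=
  Subring.closure ((O : Set (Rp p)) ∪ {x | ∃ i j, u i j = x})

lemma mem_genBy {p : ℕ} [Fact p.Prime] {n : ℕ} (O : Subring (Rp p))
    (u : Matrix (Fin n) (Fin n) (Rp p)) (i j : Fin n) : u i j ∈ genBy O u :=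
  Subring.subset_closure (Or.inr ⟨i, j, rfl⟩)

/-- The `δ`-Galois group `G_{u/O}`. -/
def galoisGroup {p : ℕ} [Fact p.Prime] (δ : Rp p → Rp p) {n : ℕ} (O : Subring (Rp p))
    (u : Matrix (Fin n) (Fin n) (Rp p)) : Set (Matrix (Fin n) (Fin n) (Rp p)) :=
  {c | (∀ i j, c i j ∈ O) ∧
    (∃ d : Matrix (Fin n) (Fin n) (Rp p),
      c * d = 1 ∧ d * c = 1 ∧ ∀ i j, d i j ∈ O) ∧
    ∃ σ : genBy O u ≃+* genBy O u,
      (∀ x : genBy O u, (x : Rp p) ∈ O → (σ x : Rp p) = x) ∧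
      (∀ x y : genBy O u, (y : Rp p) = δ (x : Rp p) →
        (σ y : Rp p) = δ (σ x : Rp p)) ∧
      (∀ i j, (σ ⟨u i j, mem_genBy O u i j⟩ : Rp p) = (u * c) i j)}

section

variable {p : ℕ} [Fact p.Prime] {n : ℕ}

lemma pow_succ_dvd_pow_sub_pow {A : Type*} [CommRing A] {q m : ℕ} (hm : m ≠ 0) {a b : A}
    (h : (q : A) ^ m ∣ a - b) : (q : A) ^ (m + 1) ∣ a ^ q - b ^ q := by
  rw [← (Commute.all a b).geom_sum₂_mul q, pow_succ']
  exact mul_dvd_mul (dvd_geom_sum₂_self ((dvd_pow_self _ hm).trans h)) h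

lemma eq_zero_of_forall_pow_dvd {x : Rp p} (h : ∀ m : ℕ, (p : Rp p) ^ m ∣ x) : x = 0 := by
  by_contra hx
  have hfin : FiniteMultiplicity (p : Rp p) x :=
    FiniteMultiplicity.of_not_isUnit (WittVector.irreducible p).not_isUnit hx
  exact FiniteMultiplicity.not_iff_forall.mpr h hfin

lemma pow_dvd_of_pow_dvd_frobW {x : Rp p} {m : ℕ} (h : (p : Rp p) ^ m ∣ frobW p x) :
    (p : Rp p) ^ m ∣ x := by
  obtain ⟨e, he⟩ := h
  obtain ⟨y, rfl⟩ := (WittVector.frobenius_bijective p (AlgebraicClosure (ZMod p))).2 e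
  refine ⟨y, (WittVector.frobenius_bijective p (AlgebraicClosure (ZMod p))).1 ?_⟩
  simpa using he

/-- Divisibility of all entries is preserved by left multiplication. -/
lemma Matrix.dvd_mul_apply {A : Type*} [CommRing A] {r : A} (M : Matrix (Fin n) (Fin n) A)
    {N : Matrix (Fin n) (Fin n) A} (h : ∀ i j, r ∣ N i j) (i j : Fin n) : r ∣ (M * N) i j := by
  rw [Matrix.mul_apply]
  exact Finset.dvd_sum fun k _ => (h k j).mul_left _

/-- Elements of the `δ`-Galois group send `u` to another solution `u * c` of the equation. -/
lemma map_frobW_mul_of_mem_galoisGroup {δ : Rp p → Rp p}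
    (hδ : ∀ a, frobW p a = a ^ p + p * δ a) {O : Subring (Rp p)}
    {α u c : Matrix (Fin n) (Fin n) (Rp p)} (hαO : ∀ i j, α i j ∈ O)
    (heq : u.map (frobW p) = (1 + (p : Rp p) • α) * u.map (· ^ p))
    (hc : c ∈ galoisGroup δ O u) :
    u.map (frobW p) * c.map (frobW p) = (1 + (p : Rp p) • α) * (u * c).map (· ^ p) := by
  obtain ⟨-, -, σ, hσO, hσδ, hσu⟩ := hc
  have hp0 : (p : Rp p) ≠ 0 := (WittVector.irreducible p).ne_zero
  have hα (i j) : α i j ∈ genBy O u := Subring.subset_closure (Or.inl (hαO i j))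
  rw [← Matrix.map_mul]
  ext1 i j
  have hδu : δ (u i j) = ∑ k, α i k * u k j ^ p := by
    have h := congrFun (congrFun heq i) j
    rw [Matrix.map_apply, hδ, add_mul, one_mul, Matrix.smul_mul, Matrix.add_apply,
      Matrix.smul_apply, Matrix.mul_apply, smul_eq_mul, Matrix.map_apply] at h
    simpa using mul_left_cancel₀ hp0 (add_left_cancel h)
  have hσ := hσδ ⟨u i j, mem_genBy O u i j⟩
    (∑ k, ⟨α i k, hα i k⟩ * ⟨u k j, mem_genBy O u k j⟩ ^ p) (by simp [hδu])
  rw [hσu, map_sum] at hσ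
  simp only [map_mul, map_pow, AddSubmonoidClass.coe_finsetSum, Subring.coe_mul,
    SubmonoidClass.coe_pow, hσu] at hσ
  simp only [fun k => hσO ⟨α i k, hα i k⟩ (hαO i k)] at hσ
  rw [Matrix.map_apply, hδ, ← hσ, add_mul, one_mul, Matrix.smul_mul, Matrix.add_apply,
    Matrix.smul_apply, Matrix.mul_apply (M := α), smul_eq_mul]
  simp only [Matrix.map_apply]

/-- A matrix `c` for which `u * c` solves the equation of `u` is determined by its reduction
modulo `p`. -/
lemma eq_of_forall_dvd_sub {B u c d : Matrix (Fin n) (Fin n) (Rp p)} (hu : IsUnit u)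
    (hc : u.map (frobW p) * c.map (frobW p) = B * (u * c).map (· ^ p))
    (hd : u.map (frobW p) * d.map (frobW p) = B * (u * d).map (· ^ p))
    (h : ∀ i j, (p : Rp p) ∣ c i j - d i j) : c = d := by
  obtain ⟨v, -, hvu⟩ := isUnit_iff_exists.mp hu
  have hvu' : v.map (frobW p) * u.map (frobW p) = 1 := by
    rw [← Matrix.map_mul, hvu, Matrix.map_one _ (map_zero _) (map_one _)]
  have hsub : (c - d).map (frobW p) =
      v.map (frobW p) * (B * ((u * c).map (· ^ p) - (u * d).map (· ^ p))) := by
    rw [mul_sub, ← hc, ← hd, ← mul_sub, ← mul_assoc, hvu', one_mul]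
    ext1 i j
    simp
  have key (m : ℕ) : ∀ i j, (p : Rp p) ^ (m + 1) ∣ (c - d) i j := by
    induction m with
    | zero => simpa using h
    | succ m ih =>
      intro i j
      apply pow_dvd_of_pow_dvd_frobW
      rw [← Matrix.map_apply (f := frobW p) (M := c - d), hsub]
      refine Matrix.dvd_mul_apply _ (Matrix.dvd_mul_apply _ fun k l => ?_) i j
      refine pow_succ_dvd_pow_sub_pow m.succ_ne_zero ?_
      rw [← Matrix.sub_apply, ← mul_sub]
      exact Matrix.dvd_mul_apply _ ih k l
  ext1 i j
  exact sub_eq_zero.mp (eq_zero_of_forall_pow_dvd fun m =>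
    (pow_dvd_pow _ m.le_succ).trans (key m i j))

end

/-- if `O` is a valuation `δ`-subring of `R` with finite residue field,
then the `δ`-Galois group `G_{u/O}` is finite (here `Δ = 0`). -/
theorem statement15 {p : ℕ} [Fact p.Prime] (hp2 : p ≠ 2)
    (δ : Rp p → Rp p) (hδ : ∀ a, frobW p a = a ^ p + p * δ a)
    (n : ℕ) (hn : 1 ≤ n)
    (O : Subring (Rp p)) (hOδ : ∀ x ∈ O, δ x ∈ O)
    (hOval : ∃ F : Subfield (Kp p),
      O = (F.toSubring).comap (algebraMap (Rp p) (Kp p)))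
    (hres : Finite ((↥O) ⧸ Ideal.span {(p : ↥O)}))
    (α : Matrix (Fin n) (Fin n) (Rp p)) (hαO : ∀ i j, α i j ∈ O)
    (u : Matrix (Fin n) (Fin n) (Rp p)) (hu : IsUnit u)
    (heq : u.map (frobW p) = (1 + (p : Rp p) • α) * u.map (· ^ p)) :
    (galoisGroup δ O u).Finite := by
  have hinj : Function.Injective
      (fun (c : galoisGroup δ O u) (i j : Fin n) =>
        Ideal.Quotient.mk (Ideal.span {(p : O)}) ⟨c.1 i j, c.2.1 i j⟩) := by
    intro c d hcd
    refine Subtype.ext (eq_of_forall_dvd_sub hu (map_frobW_mul_of_mem_galoisGroup hδ hαO heq c.2)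
      (map_frobW_mul_of_mem_galoisGroup hδ hαO heq d.2) fun i j => ?_)
    have hij := Ideal.mem_span_singleton.mp (Ideal.Quotient.eq.mp (congrFun (congrFun hcd i) j))
    simpa using map_dvd O.subtype hij
  exact Set.finite_coe_iff.mp (Finite.of_injective _ hinj)
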